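/- arXiv:2103.00647 — 9 statements merged into one kernel-verified Lean document; each statement's English description precedes it below -/
import Mathlib

section
/- Let M be an n×n real symmetric positive semidefinite matrix and write its characteristic polynomial as p_M(x) = x^n + m_{n-1}x^{n-1} + … + m_1 x + m_0. Then the coefficient sequence m_0, m_1, …, m_{n-1}, m_n = 1 is log-concave, i.e., m_k^2 ≥ m_{k-1}·m_{k+1} for all k = 1, …, n-1. -/
open Matrix BigOperators

/-- The distance matrix of a graph: the `(u,v)` entry is the graph distance from `u` to `v`. -/
noncomputable def distMatrix {V : Type*} [Fintype V] (G : SimpleGraph V) : Matrix V V ℝ :=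
  Matrix.of fun u v => (G.dist u v : ℝ)

/-- The transmission of a vertex: the sum of the distances to all vertices. -/
noncomputable def transmission {V : Type*} [Fintype V] (G : SimpleGraph V) (v : V) : ℝ :=
  ∑ u, (G.dist v u : ℝ)

/-- The distance signless Laplacian `D^Q(G) = T(G) + D(G)`. -/
noncomputable def distSignlessLap {V : Type*} [Fintype V] [DecidableEq V] (G : SimpleGraph V) :
    Matrix V V ℝ :=
  Matrix.diagonal (transmission G) + distMatrix G

/-- The distance Laplacian `D^L(G) = T(G) - D(G)`. -/
noncomputable def distLap {V : Type*} [Fintype V] [DecidableEq V] (G : SimpleGraph V) :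
    Matrix V V ℝ :=
  Matrix.diagonal (transmission G) - distMatrix G

/-- The normalized distance Laplacian `D^NL(G) = T(G)^{-1/2} D^L(G) T(G)^{-1/2}`. -/
noncomputable def normDistLap {V : Type*} [Fintype V] [DecidableEq V] (G : SimpleGraph V) :
    Matrix V V ℝ :=
  Matrix.diagonal (fun v => (Real.sqrt (transmission G v))⁻¹) * distLap G *
    Matrix.diagonal (fun v => (Real.sqrt (transmission G v))⁻¹)

/-- The spectral radius of a real matrix: the supremum of absolute values of its
(real) eigenvalues. -/
noncomputable def specRad {V : Type*} [Fintype V] [DecidableEq V] (M : Matrix V V ℝ) : ℝ :=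
  sSup (abs '' spectrum ℝ M)

/-- The vector `e_u - e_v`. -/
noncomputable def signVec {V : Type*} [DecidableEq V] (u v : V) : V → ℝ :=
  Pi.single u 1 - Pi.single v 1

open Polynomial in
/-- A product of linear factors `X - a` with `a ≥ 0` has, up to alternating signs, a nonnegative
coefficient sequence that is log-concave in the strong sense that it has no internal zeros. -/
theorem exists_logConcave_abs_coeff_prod_X_sub_C {ι : Type*} (s : Finset ι) (a : ι → ℝ)
    (ha : ∀ i, 0 ≤ a i) :
    ∃ (ε : ℝ) (d : ℕ → ℝ), ε ^ 2 = 1 ∧ (∀ k, 0 ≤ d k) ∧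
      (∀ k, (∏ i ∈ s, (X - C (a i))).coeff k = ε * (-1) ^ k * d k) ∧
      ∀ i j, i ≤ j → d i * d (j + 1) ≤ d (i + 1) * d j := by
  classical
  induction s using Finset.induction_on with
  | empty =>
    refine ⟨1, fun k => if k = 0 then 1 else 0, by norm_num, fun k => by positivity,
      fun k => ?_, fun i j _ => by simp⟩
    by_cases hk : k = 0 <;> simp [hk, coeff_one]
  | insert i₀ s hi ih =>
    obtain ⟨ε, d, hε, hd, hc, hlc⟩ := ih
    have h0 : 0 ≤ a i₀ := ha i₀
    rw [Finset.prod_insert hi, mul_comm]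
    refine ⟨-ε, fun k => Nat.casesOn k (a i₀ * d 0) fun m => d m + a i₀ * d (m + 1),
      by rw [neg_sq, hε], ?_, ?_, ?_⟩
    · rintro (_ | k)
      · exact mul_nonneg h0 (hd 0)
      · exact add_nonneg (hd k) (mul_nonneg h0 (hd (k + 1)))
    · rintro (_ | k)
      · simp [mul_sub, hc]
        ring
      · simp only [mul_sub, coeff_sub, coeff_mul_X, coeff_mul_C, hc]
        ring
    · rintro (_ | i) (_ | j) hij
      · exact (mul_comm _ _).le
      · have h1 := mul_nonneg (sq_nonneg (a i₀)) (sub_nonneg.2 (hlc 0 (j + 1) (Nat.zero_le _)))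
        rw [zero_add] at h1
        have h2 := mul_nonneg h0 (mul_nonneg (hd 1) (hd j))
        have h3 := mul_nonneg (hd 0) (hd j)
        change a i₀ * d 0 * (d (j + 1) + a i₀ * d (j + 1 + 1)) ≤
          (d 0 + a i₀ * d 1) * (d j + a i₀ * d (j + 1))
        linarith
      · omega
      · have hij' : i ≤ j := by omega
        have h1 := mul_nonneg (sq_nonneg (a i₀)) (sub_nonneg.2 (hlc (i + 1) (j + 1) hij))
        have h2 := hlc i j hij'
        have h3 : d i * d (j + 2) ≤ d (i + 2) * d j := by
          rcases hij'.eq_or_lt with rfl | hlt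
          · exact (mul_comm _ _).le
          · exact (hlc i (j + 1) (by omega)).trans (hlc (i + 1) j hlt)
        have h4 := mul_nonneg h0 (sub_nonneg.2 h3)
        simp only [add_assoc, Nat.reduceAdd] at h1 ⊢
        linarith

/-- The coefficient sequence of the characteristic polynomial of a real symmetric positive
semidefinite matrix is log-concave. -/
theorem charpoly_coeff_log_concave_of_posSemidef {n : ℕ} (M : Matrix (Fin n) (Fin n) ℝ)
    (hsym : M.IsSymm) (hpsd : M.PosSemidef) :
    ∀ k : ℕ, 1 ≤ k → k ≤ n - 1 →
      M.charpoly.coeff (k - 1) * M.charpoly.coeff (k + 1) ≤ (M.charpoly.coeff k) ^ 2 := by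
  intro k hk _
  obtain ⟨m, rfl⟩ := Nat.exists_eq_add_of_le' hk
  obtain ⟨ε, d, hε, -, hc, hlc⟩ := exists_logConcave_abs_coeff_prod_X_sub_C Finset.univ
    hpsd.isHermitian.eigenvalues hpsd.eigenvalues_nonneg
  have hM : ∀ k, M.charpoly.coeff k = ε * (-1) ^ k * d k := fun k => by
    rw [hpsd.isHermitian.charpoly_eq]
    exact hc k
  have hs : ((-1 : ℝ) ^ m) ^ 2 = 1 := by rw [← pow_mul, mul_comm, pow_mul]; norm_num
  rw [Nat.add_sub_cancel, hM, hM, hM]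
  calc _ = ε ^ 2 * ((-1) ^ m) ^ 2 * (d m * d (m + 1 + 1)) := by ring
    _ ≤ ε ^ 2 * ((-1) ^ m) ^ 2 * (d (m + 1) * d (m + 1)) := by
      rw [hε, hs, one_mul, one_mul, one_mul]
      exact hlc m (m + 1) m.le_succ
    _ = _ := by ring
end

section
/- Let M be an n×n real symmetric positive semidefinite matrix and write its characteristic polynomial as p_M(x) = x^n + m_{n-1}x^{n-1} + … + m_1 x + m_0. Then the sequence of absolute values |m_0|, |m_1|, …, |m_{n-1}|, |m_n| = 1 is unimodal, i.e., there exists an index k such that |m_{i-1}| ≤ |m_i| for all i ≤ k and |m_i| ≥ |m_{i+1}| for all i ≥ k. -/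
open Matrix BigOperators

open Polynomial in
theorem Polynomial.coeff_nonneg_X_add_C_mul {p : ℝ[X]} {a : ℝ} (ha : 0 ≤ a)
    (hp : ∀ i, 0 ≤ p.coeff i) (i : ℕ) : 0 ≤ ((X + C a) * p).coeff i := by
  cases i with
  | zero => simpa [add_mul] using mul_nonneg ha (hp 0)
  | succ i => simpa [add_mul] using add_nonneg (hp i) (mul_nonneg ha (hp (i + 1)))

open Polynomial in
/-- Multiplication by `X + C a` with `0 ≤ a` preserves log-concavity (without internal zeros) of
a nonnegative coefficient sequence. -/
theorem Polynomial.coeff_mul_coeff_le_X_add_C_mul {p : ℝ[X]} {a : ℝ} (ha : 0 ≤ a)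
    (hp : ∀ i, 0 ≤ p.coeff i)
    (hlc : ∀ i j, i ≤ j → p.coeff i * p.coeff (j + 2) ≤ p.coeff (i + 1) * p.coeff (j + 1))
    (i j : ℕ) (hij : i ≤ j) :
    ((X + C a) * p).coeff i * ((X + C a) * p).coeff (j + 2) ≤
      ((X + C a) * p).coeff (i + 1) * ((X + C a) * p).coeff (j + 1) := by
  have hmid : ∀ i j, i ≤ j →
      p.coeff i * p.coeff (j + 3) ≤ p.coeff (i + 2) * p.coeff (j + 1) := by
    intro i j hij
    rcases hij.eq_or_lt with rfl | hlt
    · linarith [hlc i (i + 1) (by lia)]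
    · obtain ⟨j, rfl⟩ : ∃ m, j = m + 1 := ⟨j - 1, by lia⟩
      exact (hlc i (j + 2) (by lia)).trans (hlc (i + 1) (j + 1) (by lia))
  have hsq := mul_nonneg (mul_nonneg ha ha) (sub_nonneg.2 (hlc i j hij))
  cases i with
  | zero =>
    have h0 := mul_nonneg (hp 0) (hp j)
    have h1 := mul_nonneg ha (mul_nonneg (hp 1) (hp j))
    simp only [add_mul, coeff_add, coeff_X_mul, coeff_X_mul_zero, coeff_C_mul, zero_add] at *
    linarith
  | succ i =>
    obtain ⟨j, rfl⟩ : ∃ m, j = m + 1 := ⟨j - 1, by lia⟩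
    have h0 := hlc i j (by lia)
    have h1 := mul_nonneg ha (sub_nonneg.2 (hmid i j (by lia)))
    simp only [add_mul, coeff_add, coeff_X_mul, coeff_C_mul] at *
    linarith

open Polynomial in
theorem Multiset.prod_X_add_C_coeff_logConcave (s : Multiset ℝ) (hs : ∀ a ∈ s, 0 ≤ a) :
    (∀ i, 0 ≤ (s.map fun a => X + C a).prod.coeff i) ∧
      ∀ i j, i ≤ j → (s.map fun a => X + C a).prod.coeff i *
        (s.map fun a => X + C a).prod.coeff (j + 2) ≤
          (s.map fun a => X + C a).prod.coeff (i + 1) *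
            (s.map fun a => X + C a).prod.coeff (j + 1) := by
  induction s using Multiset.induction with
  | empty =>
    constructor
    · intro i
      simp only [Multiset.map_zero, Multiset.prod_zero, coeff_one]
      split_ifs <;> simp
    · intro i j _
      simp [coeff_one]
  | cons a s ih =>
    obtain ⟨hnn, hlc⟩ := ih fun b hb => hs b (Multiset.mem_cons_of_mem hb)
    have ha := hs a (Multiset.mem_cons_self a s)
    simp only [Multiset.map_cons, Multiset.prod_cons]
    exact ⟨coeff_nonneg_X_add_C_mul ha hnn, coeff_mul_coeff_le_X_add_C_mul ha hnn hlc⟩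

open Polynomial in
theorem Multiset.abs_prod_X_sub_C_coeff (s : Multiset ℝ) (hs : ∀ a ∈ s, 0 ≤ a) {i : ℕ}
    (hi : i ≤ s.card) :
    |(s.map fun a => X - C a).prod.coeff i| = (s.map fun a => X + C a).prod.coeff i := by
  rw [← abs_of_nonneg ((s.prod_X_add_C_coeff_logConcave hs).1 i), s.prod_X_sub_C_coeff hi,
    s.prod_X_add_C_coeff hi, abs_mul, abs_pow, abs_neg, abs_one, one_pow, one_mul]

/-- A log-concave sequence that is positive at `n` is unimodal on `{0, …, n}`. -/
theorem exists_unimodal_of_logConcave {c : ℕ → ℝ} {n : ℕ} (hnn : ∀ i, 0 ≤ c i) (hn : 0 < c n)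
    (hlc : ∀ i j, i ≤ j → c i * c (j + 2) ≤ c (i + 1) * c (j + 1)) :
    ∃ k ≤ n, (∀ i, 1 ≤ i → i ≤ k → c (i - 1) ≤ c i) ∧
      ∀ i, k ≤ i → i + 1 ≤ n → c (i + 1) ≤ c i := by
  obtain ⟨k, hk, hmax⟩ := Finset.exists_max_image (Finset.range (n + 1)) c ⟨n, by simp⟩
  simp only [Finset.mem_range, Nat.lt_succ_iff] at hk hmax
  have hpos : 0 < c k := hn.trans_le (hmax n le_rfl)
  refine ⟨k, hk, fun i hi hik => ?_, fun i hki hin => ?_⟩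
  · rcases hik.eq_or_lt with rfl | hlt
    · exact hmax _ (by lia)
    · obtain ⟨i, rfl⟩ : ∃ m, i = m + 1 := ⟨i - 1, by lia⟩
      obtain ⟨k, rfl⟩ : ∃ m, k = m + 2 := ⟨k - 2, by lia⟩
      exact le_of_mul_le_mul_right ((hlc i k (by lia)).trans
        (mul_le_mul_of_nonneg_left (hmax _ (by lia)) (hnn _))) hpos
  · rcases hki.eq_or_lt with rfl | hlt
    · exact hmax _ hin
    · obtain ⟨i, rfl⟩ : ∃ m, i = m + 1 := ⟨i - 1, by lia⟩
      exact le_of_mul_le_mul_left ((hlc k i (by lia)).trans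
        (mul_le_mul_of_nonneg_right (hmax _ (by lia)) (hnn _))) hpos

/-- The sequence of absolute values of the coefficients of the characteristic polynomial of a
real symmetric positive semidefinite matrix is unimodal. -/
theorem charpoly_coeff_abs_unimodal_of_posSemidef {n : ℕ} (M : Matrix (Fin n) (Fin n) ℝ)
    (hsym : M.IsSymm) (hpsd : M.PosSemidef) :
    ∃ k ≤ n,
      (∀ i : ℕ, 1 ≤ i → i ≤ k → |M.charpoly.coeff (i - 1)| ≤ |M.charpoly.coeff i|) ∧
      (∀ i : ℕ, k ≤ i → i + 1 ≤ n → |M.charpoly.coeff (i + 1)| ≤ |M.charpoly.coeff i|) := by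
  let s : Multiset ℝ := Finset.univ.val.map hpsd.1.eigenvalues
  have hs : ∀ a ∈ s, 0 ≤ a := by
    intro a ha
    obtain ⟨i, -, rfl⟩ := Multiset.mem_map.1 ha
    exact hpsd.eigenvalues_nonneg i
  have hcard : s.card = n := by simp [s]
  have hchar : M.charpoly = (s.map fun a => Polynomial.X - Polynomial.C a).prod := by
    rw [hpsd.1.charpoly_eq, Multiset.map_map]
    rfl
  have habs : ∀ i ≤ n, |M.charpoly.coeff i| =
      (s.map fun a => Polynomial.X + Polynomial.C a).prod.coeff i := by
    intro i hi
    rw [hchar, s.abs_prod_X_sub_C_coeff hs (hi.trans_eq hcard.symm)]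
  have hlead : (s.map fun a => Polynomial.X + Polynomial.C a).prod.coeff n = 1 := by
    simp [s.prod_X_add_C_coeff hcard.ge, hcard, Multiset.esymm]
  obtain ⟨hnn, hlc⟩ := s.prod_X_add_C_coeff_logConcave hs
  obtain ⟨k, hk, hinc, hdec⟩ := exists_unimodal_of_logConcave hnn (hlead ▸ one_pos) hlc
  refine ⟨k, hk, fun i hi hik => ?_, fun i hki hin => ?_⟩
  · rw [habs _ (by lia), habs _ (by lia)]
    exact hinc i hi hik
  · rw [habs _ hin, habs _ (by lia)]
    exact hdec i hki hin
end

section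
/- Let G be a connected simple graph on n ≥ 3 vertices and let u ≠ v be twin vertices of G, and let t = t(u) = t(v) be their common transmission. If u and v are independent twins, then e_u − e_v is an eigenvector of the distance Laplacian D^L(G) with eigenvalue t + 2; if u and v are adjacent twins, then e_u − e_v is an eigenvector of D^L(G) with eigenvalue t + 1. -/
open Matrix BigOperators

open SimpleGraph in
/-- If every neighbor of `v` other than `u` is a neighbor of `u`, then `u` is at least as close
as `v` to every vertex other than `v`. -/
theorem SimpleGraph.Connected.dist_le_dist_of_forall_adj {V : Type*} {G : SimpleGraph V}
    (hG : G.Connected) {u v w : V} (h : ∀ x, x ≠ u → G.Adj v x → G.Adj u x) (hw : w ≠ v) :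
    G.dist u w ≤ G.dist v w := by
  obtain ⟨p, hp⟩ := hG.exists_walk_length_eq_dist v w
  rw [← hp]
  cases p with
  | nil => exact absurd rfl hw
  | @cons _ x _ hvx q =>
    rw [Walk.length_cons]
    by_cases hx : x = u
    · subst hx
      exact (dist_le q).trans (Nat.le_succ _)
    · exact dist_le (Walk.cons (h x hx hvx) q)

/-- Vertices with the same neighbors outside of `{u, v}` have the same distance to every
other vertex. -/
theorem SimpleGraph.Connected.dist_eq_dist_of_forall_adj_iff {V : Type*} {G : SimpleGraph V}
    (hG : G.Connected) {u v : V} (h : ∀ x, x ≠ u → x ≠ v → (G.Adj u x ↔ G.Adj v x))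
    (w : V) (hwu : w ≠ u) (hwv : w ≠ v) : G.dist u w = G.dist v w :=
  le_antisymm
    (hG.dist_le_dist_of_forall_adj (fun x hx hvx => (h x hx hvx.ne').2 hvx) hwv)
    (hG.dist_le_dist_of_forall_adj (fun x hx hux => (h x hux.ne' hx).1 hux) hwu)

/-- Independent twins of a connected graph are at distance two. -/
theorem SimpleGraph.Connected.dist_eq_two_of_neighborSet_eq {V : Type*} {G : SimpleGraph V}
    (hG : G.Connected) {u v : V} (huv : u ≠ v) (h : G.neighborSet u = G.neighborSet v) :
    G.dist u v = 2 := by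
  have hadj : ∀ x, G.Adj u x ↔ G.Adj v x := fun x => Set.ext_iff.1 h x
  have : Nontrivial V := ⟨u, v, huv⟩
  obtain ⟨x, hx⟩ := hG.preconnected.exists_adj_of_nontrivial u
  have hle : G.dist u v ≤ 2 :=
    SimpleGraph.dist_le (SimpleGraph.Walk.cons hx (((hadj x).1 hx).symm.toWalk))
  have hpos := hG.pos_dist_of_ne huv
  have hne : G.dist u v ≠ 1 := fun h1 =>
    G.irrefl ((hadj v).1 (SimpleGraph.dist_eq_one_iff_adj.1 h1))
  omega

theorem transmission_eq_of_forall_dist_eq {V : Type*} [Fintype V] [DecidableEq V]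
    {G : SimpleGraph V} {u v : V} (h : ∀ w, w ≠ u → w ≠ v → G.dist u w = G.dist v w) :
    transmission G u = transmission G v := by
  refine Fintype.sum_equiv (Equiv.swap u v) _ _ fun w => ?_
  by_cases hu : w = u
  · simp [hu]
  by_cases hv : w = v
  · simp [hv, SimpleGraph.dist_comm]
  rw [Equiv.swap_apply_of_ne_of_ne hu hv, h w hu hv]

theorem signVec_ne_zero {V : Type*} [DecidableEq V] {u v : V} (huv : u ≠ v) :
    signVec u v ≠ 0 := fun h => by
  simpa [signVec, huv] using congrFun h u

theorem distLap_mulVec_signVec {V : Type*} [Fintype V] [DecidableEq V]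
    {G : SimpleGraph V} {u v : V} (huv : u ≠ v)
    (h : ∀ w, w ≠ u → w ≠ v → G.dist u w = G.dist v w) :
    distLap G *ᵥ signVec u v = (transmission G u + G.dist u v) • signVec u v := by
  have ht := transmission_eq_of_forall_dist_eq h
  ext w
  by_cases hu : w = u
  · subst hu
    simp [signVec, mulVec_sub, distLap, distMatrix, huv]
  by_cases hv : w = v
  · subst hv
    simp [signVec, mulVec_sub, distLap, distMatrix, hu, ht, SimpleGraph.dist_comm]
    ring
  simp [signVec, mulVec_sub, distLap, distMatrix, hu, hv, SimpleGraph.dist_comm (u := w), h w hu hv]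

/-- For twin vertices `u ≠ v` of a connected graph on at least three vertices with common
transmission `t`, the vector `e_u - e_v` is an eigenvector of the distance Laplacian, with
eigenvalue `t + 2` for independent twins and `t + 1` for adjacent twins. -/
theorem distLap_eigenvector_of_twins {n : ℕ} (hn : 3 ≤ n) (G : SimpleGraph (Fin n))
    (hG : G.Connected) (u v : Fin n) (huv : u ≠ v) :
    (G.neighborSet u = G.neighborSet v →
      transmission G u = transmission G v ∧
      signVec u v ≠ 0 ∧
      distLap G *ᵥ signVec u v = (transmission G u + 2) • signVec u v) ∧
    (G.neighborSet u ∪ {u} = G.neighborSet v ∪ {v} →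
      transmission G u = transmission G v ∧
      signVec u v ≠ 0 ∧
      distLap G *ᵥ signVec u v = (transmission G u + 1) • signVec u v) := by
  constructor
  · intro h
    have hd := hG.dist_eq_dist_of_forall_adj_iff fun x _ _ => Set.ext_iff.1 h x
    refine ⟨transmission_eq_of_forall_dist_eq hd, signVec_ne_zero huv, ?_⟩
    rw [distLap_mulVec_signVec huv hd, hG.dist_eq_two_of_neighborSet_eq huv h, Nat.cast_ofNat]
  · intro h
    have hd := hG.dist_eq_dist_of_forall_adj_iff (u := u) (v := v) fun x hxu hxv => by
      simpa [hxu, hxv] using Set.ext_iff.1 h x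
    have hadj : G.Adj u v := by simpa [huv.symm] using Set.ext_iff.1 h v
    refine ⟨transmission_eq_of_forall_dist_eq hd, signVec_ne_zero huv, ?_⟩
    rw [distLap_mulVec_signVec huv hd, SimpleGraph.dist_eq_one_iff_adj.2 hadj, Nat.cast_one]
end

section
/- Let G be a connected simple graph on n vertices, let u ≠ v be nonadjacent vertices of G, and let G + uv denote the graph obtained from G by adding the edge uv. Then the spectral radius of the distance matrix strictly decreases: ρ(D(G)) > ρ(D(G + uv)). -/
open Matrix BigOperators

section SpecRad

variable {V : Type*} [Fintype V] [DecidableEq V] {A B : Matrix V V ℝ}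

theorem Matrix.IsHermitian.finite_abs_spectrum (hA : A.IsHermitian) :
    (abs '' spectrum ℝ A).Finite := by
  rw [hA.spectrum_real_eq_range_eigenvalues]
  exact (Set.finite_range _).image _

theorem Matrix.IsHermitian.le_specRad (hA : A.IsHermitian) {μ : ℝ} (hμ : μ ∈ spectrum ℝ A) :
    μ ≤ specRad A :=
  (le_abs_self μ).trans <| le_csSup hA.finite_abs_spectrum.bddAbove <| Set.mem_image_of_mem _ hμ

theorem Matrix.IsHermitian.posSemidef_scalar_sub (hA : A.IsHermitian) {r : ℝ}
    (hr : specRad A ≤ r) : (algebraMap ℝ (Matrix V V ℝ) r - A).PosSemidef := by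
  refine posSemidef_iff_isHermitian_and_spectrum_nonneg.2 ⟨?_, ?_⟩
  · refine IsHermitian.sub ?_ hA
    simp [Matrix.algebraMap_eq_diagonal, IsHermitian]
  · rw [← spectrum.singleton_sub_eq]
    rintro _ ⟨_, rfl, μ, hμ, rfl⟩
    exact sub_nonneg.2 ((hA.le_specRad hμ).trans hr)

/-- The spectral radius of a real symmetric matrix is attained at an eigenvector. -/
theorem Matrix.IsHermitian.exists_eigenvector_specRad [Nonempty V] (hA : A.IsHermitian) :
    ∃ (μ : ℝ) (x : V → ℝ), |μ| = specRad A ∧ x ≠ 0 ∧ A *ᵥ x = μ • x := by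
  have hne : (abs '' spectrum ℝ A).Nonempty := by
    rw [hA.spectrum_real_eq_range_eigenvalues]
    exact (Set.range_nonempty _).image _
  obtain ⟨μ, hμ, h⟩ := hne.csSup_mem hA.finite_abs_spectrum
  rw [hA.spectrum_real_eq_range_eigenvalues] at hμ
  obtain ⟨i, rfl⟩ := hμ
  refine ⟨_, hA.eigenvectorBasis i, h, fun h0 => ?_, hA.mulVec_eigenvectorBasis i⟩
  exact hA.eigenvectorBasis.orthonormal.ne_zero i (PiLp.ext (congrFun h0))

/-- Strict monotonicity of the spectral radius for symmetric nonnegative matrices, the larger of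
which is positive off the diagonal. -/
theorem specRad_lt_specRad_of_entrywise_le (hA : A.IsHermitian) (hB : B.IsHermitian)
    (hB0 : ∀ i j, 0 ≤ B i j) (hBA : ∀ i j, B i j ≤ A i j) (hpos : ∀ i j, i ≠ j → 0 < A i j)
    {u v : V} (huv : B u v < A u v) : specRad B < specRad A := by
  have : Nonempty V := ⟨u⟩
  by_contra! hle
  obtain ⟨μ, x, hμ, hx, hBx⟩ := hB.exists_eigenvector_specRad
  set y : V → ℝ := fun i => |x i| with hy
  have hy0 : ∀ i, 0 ≤ y i := fun i => abs_nonneg _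
  have hlow : ∀ i, specRad B * y i ≤ (B *ᵥ y) i := fun i => by
    rw [← hμ, hy, ← abs_mul, ← smul_eq_mul, ← Pi.smul_apply, ← hBx]
    refine (Finset.abs_sum_le_sum_abs _ _).trans_eq (Finset.sum_congr rfl fun j _ => ?_)
    rw [abs_mul, abs_of_nonneg (hB0 i j)]
  have hterm : ∀ i j, B i j * y j ≤ A i j * y j := fun i j =>
    mul_le_mul_of_nonneg_right (hBA i j) (hy0 j)
  have hmono : ∀ i, (B *ᵥ y) i ≤ (A *ᵥ y) i := fun i => Finset.sum_le_sum fun j _ => hterm i j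
  have hpsd := hA.posSemidef_scalar_sub hle
  have hM : ∀ i, ((algebraMap ℝ (Matrix V V ℝ) (specRad B) - A) *ᵥ y) i
      = specRad B * y i - (A *ᵥ y) i := fun i => by
    simp [sub_mulVec, Matrix.algebraMap_eq_diagonal, mulVec_diagonal]
  have hker : (algebraMap ℝ (Matrix V V ℝ) (specRad B) - A) *ᵥ y = 0 := by
    refine (hpsd.dotProduct_mulVec_zero_iff y).1 (le_antisymm ?_ (hpsd.dotProduct_mulVec_nonneg y))
    refine Finset.sum_nonpos fun i _ => ?_
    rw [hM, star_trivial]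
    exact mul_nonpos_of_nonneg_of_nonpos (hy0 i) (sub_nonpos.2 ((hlow i).trans (hmono i)))
  have heig : ∀ i, specRad B * y i = (A *ᵥ y) i := fun i =>
    sub_eq_zero.1 ((hM i).symm.trans (congrFun hker i))
  obtain ⟨k, hk⟩ := Function.ne_iff.1 hx
  have hypos : ∀ i, 0 < y i := fun i => by
    refine (hy0 i).lt_of_ne' fun hi => ?_
    have hki : i ≠ k := by
      rintro rfl
      exact hk (abs_eq_zero.1 hi)
    have hsum : 0 < (A *ᵥ y) i :=
      Finset.sum_pos' (fun j _ => mul_nonneg ((hB0 i j).trans (hBA i j)) (hy0 j))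
        ⟨k, Finset.mem_univ k, mul_pos (hpos i k hki) (abs_pos.2 hk)⟩
    rw [← heig, hi, mul_zero] at hsum
    exact hsum.false
  have hlt : (B *ᵥ y) u < (A *ᵥ y) u :=
    Finset.sum_lt_sum (fun j _ => hterm u j)
      ⟨v, Finset.mem_univ v, mul_lt_mul_of_pos_right huv (hypos v)⟩
  exact (hlow u).not_gt (heig u ▸ hlt)

end SpecRad

theorem isHermitian_distMatrix {V : Type*} [Fintype V] (G : SimpleGraph V) :
    (distMatrix G).IsHermitian := by
  ext i j
  simp [distMatrix, SimpleGraph.dist_comm]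

/-- Adding an edge between nonadjacent vertices of a connected graph strictly decreases the
spectral radius of the distance matrix. -/
theorem specRad_distMatrix_strict_anti_addEdge {n : ℕ} (G : SimpleGraph (Fin n))
    (hG : G.Connected) (u v : Fin n) (huv : u ≠ v) (hadj : ¬ G.Adj u v) :
    specRad (distMatrix (G ⊔ SimpleGraph.edge u v)) < specRad (distMatrix G) := by
  have hle : G ≤ G ⊔ SimpleGraph.edge u v := le_sup_left
  refine specRad_lt_specRad_of_entrywise_le (isHermitian_distMatrix G) (isHermitian_distMatrix _)
    (fun i j => Nat.cast_nonneg _) (fun i j => Nat.cast_le.2 ((hG i j).dist_anti hle))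
    (fun i j hij => Nat.cast_pos.2 (hG.pos_dist_of_ne hij)) (u := u) (v := v) (Nat.cast_lt.2 ?_)
  have hone : (G ⊔ SimpleGraph.edge u v).dist u v = 1 :=
    SimpleGraph.dist_eq_one_iff_adj.2 (by simp [SimpleGraph.edge_adj, huv])
  rw [hone]
  exact hG.one_lt_dist_of_ne_of_not_adj huv hadj
end

section
/- Let G be a connected simple graph on n vertices, let u ≠ v be nonadjacent vertices of G, and let G + uv denote the graph obtained from G by adding the edge uv. Then the spectral radius of the distance signless Laplacian strictly decreases: ρ(D^Q(G)) > ρ(D^Q(G + uv)). -/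
open Matrix BigOperators

section SpectralRadius

variable {V : Type*} [Fintype V] [DecidableEq V] {M N : Matrix V V ℝ}

lemma finite_abs_image_spectrum (M : Matrix V V ℝ) : (abs '' spectrum ℝ M).Finite :=
  M.finite_real_spectrum.image abs

lemma abs_le_specRad {x : ℝ} (hx : x ∈ spectrum ℝ M) : |x| ≤ specRad M :=
  le_csSup (finite_abs_image_spectrum M).bddAbove ⟨x, hx, rfl⟩

/-- The spectral radius of a Hermitian matrix is attained at an eigenvector. -/
lemma Matrix.IsHermitian.exists_mulVec_eq_smul_abs_eq_specRad [Nonempty V] (hM : M.IsHermitian) :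
    ∃ (x : V → ℝ) (c : ℝ), x ≠ 0 ∧ M *ᵥ x = c • x ∧ |c| = specRad M := by
  have hne : (spectrum ℝ M).Nonempty := by
    rw [hM.spectrum_real_eq_range_eigenvalues]
    exact Set.range_nonempty _
  obtain ⟨c, hc, hcM⟩ := (hne.image abs).csSup_mem (finite_abs_image_spectrum M)
  rw [← Matrix.spectrum_toLin', ← Module.End.hasEigenvalue_iff_mem_spectrum] at hc
  obtain ⟨x, hx⟩ := hc.exists_hasEigenvector
  exact ⟨x, c, hx.2, by simpa using hx.apply_eq_smul, hcM⟩

/-- The Rayleigh quotient of a Hermitian matrix is bounded by its spectral radius. -/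
lemma Matrix.IsHermitian.dotProduct_mulVec_le_specRad (hM : M.IsHermitian) (z : V → ℝ) :
    z ⬝ᵥ M *ᵥ z ≤ specRad M * (z ⬝ᵥ z) := by
  have hpos : (algebraMap ℝ (Matrix V V ℝ) (specRad M) - M).PosSemidef := by
    refine Matrix.posSemidef_iff_isHermitian_and_spectrum_nonneg.2 ⟨?_, ?_⟩
    · refine Matrix.IsHermitian.sub ?_ hM
      rw [Algebra.algebraMap_eq_smul_one]
      simp [Matrix.IsHermitian]
    · rw [← spectrum.singleton_sub_eq]
      rintro _ ⟨_, rfl, x, hx, rfl⟩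
      exact sub_nonneg.2 ((le_abs_self x).trans (abs_le_specRad hx))
  have h := hpos.dotProduct_mulVec_nonneg z
  simp only [star_trivial, Algebra.algebraMap_eq_smul_one, Matrix.sub_mulVec, Matrix.smul_mulVec,
    Matrix.one_mulVec, dotProduct_sub, dotProduct_smul, smul_eq_mul] at h
  linarith

/-- Strict monotonicity of the spectral radius for entrywise positive Hermitian matrices. -/
lemma specRad_lt_specRad_of_le_of_lt (hN : N.IsHermitian) (hM : M.IsHermitian)
    (hpos : ∀ i j, 0 < N i j) (hle : ∀ i j, N i j ≤ M i j) {a b : V} (hlt : N a b < M a b) :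
    specRad N < specRad M := by
  have : Nonempty V := ⟨a⟩
  obtain ⟨x, c, hx, hNx, hc⟩ := hN.exists_mulVec_eq_smul_abs_eq_specRad
  obtain ⟨k, hk⟩ := Function.ne_iff.1 hx
  set y : V → ℝ := fun i => |x i| with hy
  set z : V → ℝ := N *ᵥ y with hz
  have hyz : ∀ i, |c| * y i ≤ z i := fun i => by
    calc |c| * y i = |(N *ᵥ x) i| := by simp [hNx, hy, abs_mul]
      _ ≤ ∑ j, |N i j * x j| := Finset.abs_sum_le_sum_abs _ _
      _ = z i := by simp [hz, hy, mulVec, dotProduct, abs_mul, abs_of_pos (hpos _ _)]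
  have hzpos : ∀ i, 0 < z i := fun i =>
    Finset.sum_pos' (fun j _ => mul_nonneg (hpos i j).le (abs_nonneg _))
      ⟨k, Finset.mem_univ k, mul_pos (hpos i k) (abs_pos.2 hk)⟩
  have hzz : ∀ i, |c| * z i ≤ (N *ᵥ z) i := fun i => by
    calc |c| * z i = ∑ j, N i j * (|c| * y j) := by
          simp only [hz, mulVec, dotProduct, Finset.mul_sum]
          exact Finset.sum_congr rfl fun j _ => by ring
      _ ≤ (N *ᵥ z) i := Finset.sum_le_sum fun j _ =>
          mul_le_mul_of_nonneg_left (hyz j) (hpos i j).le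
  have hNMz : ∀ i, (N *ᵥ z) i ≤ (M *ᵥ z) i := fun i => Finset.sum_le_sum fun j _ =>
    mul_le_mul_of_nonneg_right (hle i j) (hzpos j).le
  have hNMa : (N *ᵥ z) a < (M *ᵥ z) a := Finset.sum_lt_sum
    (fun j _ => mul_le_mul_of_nonneg_right (hle a j) (hzpos j).le)
    ⟨b, Finset.mem_univ b, mul_lt_mul_of_pos_right hlt (hzpos b)⟩
  have hzz_pos : 0 < z ⬝ᵥ z :=
    Finset.sum_pos (fun i _ => mul_pos (hzpos i) (hzpos i)) Finset.univ_nonempty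
  refine lt_of_mul_lt_mul_right ?_ hzz_pos.le
  calc specRad N * (z ⬝ᵥ z) = ∑ i, z i * (|c| * z i) := by
        simp only [← hc, dotProduct, Finset.mul_sum]
        exact Finset.sum_congr rfl fun i _ => by ring
    _ ≤ z ⬝ᵥ N *ᵥ z := Finset.sum_le_sum fun i _ =>
        mul_le_mul_of_nonneg_left (hzz i) (hzpos i).le
    _ < z ⬝ᵥ M *ᵥ z := Finset.sum_lt_sum
        (fun i _ => mul_le_mul_of_nonneg_left (hNMz i) (hzpos i).le)
        ⟨a, Finset.mem_univ a, mul_lt_mul_of_pos_left hNMa (hzpos a)⟩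
    _ ≤ specRad M * (z ⬝ᵥ z) := hM.dotProduct_mulVec_le_specRad z

end SpectralRadius

section DistSignlessLap

variable {V : Type*} [Fintype V] [DecidableEq V] {G H : SimpleGraph V}

lemma distSignlessLap_apply_self (G : SimpleGraph V) (i : V) :
    distSignlessLap G i i = transmission G i := by
  simp [distSignlessLap, distMatrix]

lemma distSignlessLap_apply_of_ne (G : SimpleGraph V) {i j : V} (h : i ≠ j) :
    distSignlessLap G i j = G.dist i j := by
  simp [distSignlessLap, distMatrix, h]

lemma isHermitian_distSignlessLap (G : SimpleGraph V) : (distSignlessLap G).IsHermitian := by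
  refine (isHermitian_diagonal _).add (Matrix.IsHermitian.ext fun i j => ?_)
  simp [distMatrix, G.dist_comm]

lemma SimpleGraph.Connected.distSignlessLap_pos [Nontrivial V] (hG : G.Connected) (i j : V) :
    0 < distSignlessLap G i j := by
  rcases eq_or_ne i j with rfl | h
  · obtain ⟨k, hk⟩ := exists_ne i
    rw [distSignlessLap_apply_self]
    exact Finset.sum_pos' (fun _ _ => Nat.cast_nonneg _)
      ⟨k, Finset.mem_univ k, Nat.cast_pos.2 (hG.pos_dist_of_ne hk.symm)⟩
  · rw [distSignlessLap_apply_of_ne G h]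
    exact Nat.cast_pos.2 (hG.pos_dist_of_ne h)

lemma SimpleGraph.Connected.distSignlessLap_anti (hG : G.Connected) (hGH : G ≤ H) (i j : V) :
    distSignlessLap H i j ≤ distSignlessLap G i j := by
  have hdist (i j : V) : (H.dist i j : ℝ) ≤ G.dist i j :=
    Nat.cast_le.2 ((hG i j).dist_anti hGH)
  rcases eq_or_ne i j with rfl | h
  · simpa only [distSignlessLap_apply_self, transmission] using
      Finset.sum_le_sum fun k _ => hdist i k
  · simpa only [distSignlessLap_apply_of_ne _ h] using hdist i j

end DistSignlessLap

/-- Adding an edge between nonadjacent vertices of a connected graph strictly decreases the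
spectral radius of the distance signless Laplacian. -/
theorem specRad_distSignlessLap_strict_anti_addEdge {n : ℕ} (G : SimpleGraph (Fin n))
    (hG : G.Connected) (u v : Fin n) (huv : u ≠ v) (hadj : ¬ G.Adj u v) :
    specRad (distSignlessLap (G ⊔ SimpleGraph.edge u v)) < specRad (distSignlessLap G) := by
  have : Nontrivial (Fin n) := ⟨u, v, huv⟩
  have hle : G ≤ G ⊔ SimpleGraph.edge u v := le_sup_left
  refine specRad_lt_specRad_of_le_of_lt (isHermitian_distSignlessLap _)
    (isHermitian_distSignlessLap G) (hG.mono hle).distSignlessLap_pos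
    (hG.distSignlessLap_anti hle) (a := u) (b := v) ?_
  have hdist : (G ⊔ SimpleGraph.edge u v).dist u v = 1 :=
    SimpleGraph.dist_eq_one_iff_adj.2 (by simp [SimpleGraph.edge_adj, huv])
  rw [distSignlessLap_apply_of_ne _ huv, distSignlessLap_apply_of_ne _ huv, hdist]
  exact Nat.cast_lt.2 (hG.one_lt_dist_of_ne_of_not_adj huv hadj)
end

section
/- Let G be a connected simple graph on n ≥ 2 vertices. Then ρ(D^NL(G)) ≥ n/(n−1). Furthermore, if ρ(D^NL(G)) = n/(n−1), then the characteristic polynomial of D^NL(G) equals x·(x − n/(n−1))^{n−1}, i.e., the spectrum of D^NL(G) is {0, (n/(n−1))^{(n−1)}}. -/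
open Matrix BigOperators

lemma transmission_pos {V : Type*} [Fintype V] [Nontrivial V] {G : SimpleGraph V}
    (hG : G.Connected) (v : V) : 0 < transmission G v := by
  obtain ⟨w, hw⟩ := exists_ne v
  refine Finset.sum_pos' (fun u _ => Nat.cast_nonneg _) ⟨w, Finset.mem_univ w, ?_⟩
  exact_mod_cast hG.pos_dist_of_ne hw.symm

lemma isHermitian_normDistLap {V : Type*} [Fintype V] [DecidableEq V] (G : SimpleGraph V) :
    (normDistLap G).IsHermitian := by
  ext u v
  simp only [normDistLap, distLap, distMatrix, conjTranspose_apply, mul_diagonal, diagonal_mul,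
    Matrix.sub_apply, of_apply, star_trivial, G.dist_comm (u := v) (v := u)]
  by_cases h : u = v
  · subst h; rfl
  · rw [diagonal_apply_ne _ h, diagonal_apply_ne _ (Ne.symm h)]
    ring

lemma trace_normDistLap {V : Type*} [Fintype V] [DecidableEq V] [Nontrivial V]
    {G : SimpleGraph V} (hG : G.Connected) : (normDistLap G).trace = Fintype.card V := by
  have h (v : V) : normDistLap G v v = 1 := by
    have ht := transmission_pos hG v
    simp only [normDistLap, distLap, distMatrix, mul_diagonal, diagonal_mul,
      Matrix.sub_apply, of_apply, diagonal_apply_eq, SimpleGraph.dist_self, Nat.cast_zero,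
      sub_zero]
    rw [mul_right_comm, ← mul_inv, Real.mul_self_sqrt ht.le, inv_mul_cancel₀ ht.ne']
  simp [trace, h]

lemma distLap_mulVec_one {V : Type*} [Fintype V] [DecidableEq V] (G : SimpleGraph V) :
    distLap G *ᵥ 1 = 0 := by
  ext v
  simp [distLap, distMatrix, transmission, mulVec, dotProduct, diagonal_apply]

lemma det_normDistLap {V : Type*} [Fintype V] [DecidableEq V] [Nonempty V]
    (G : SimpleGraph V) : (normDistLap G).det = 0 := by
  have h : (distLap G).det = 0 :=
    exists_mulVec_eq_zero_iff.1 ⟨1, one_ne_zero, distLap_mulVec_one G⟩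
  simp [normDistLap, det_mul, h]

/-- If one of finitely many reals vanishes and no other one exceeds the average of the
others, then all the others are equal to that average. -/
lemma eq_of_forall_le_div_card {ι : Type*} [Fintype ι] [DecidableEq ι] {f : ι → ℝ} {i₀ : ι}
    (h0 : f i₀ = 0) {c : ℝ} (hsum : ∑ i, f i = (Fintype.card ι - 1) * c)
    (hle : ∀ i ≠ i₀, f i ≤ c) {i : ι} (hi : i ≠ i₀) : f i = c := by
  have hcard : ((Finset.univ.erase i₀).card : ℝ) = Fintype.card ι - 1 := by
    rw [Finset.cast_card_erase_of_mem (Finset.mem_univ _), Finset.card_univ]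
  have hs : ∑ j ∈ Finset.univ.erase i₀, f j = ∑ _j ∈ Finset.univ.erase i₀, c := by
    rw [Finset.sum_const, nsmul_eq_mul, hcard, ← hsum,
      ← Finset.add_sum_erase _ _ (Finset.mem_univ i₀), h0, zero_add]
  exact (Finset.sum_eq_sum_iff_of_le fun j hj => hle j (Finset.ne_of_mem_erase hj)).1 hs i
    (Finset.mem_erase.2 ⟨hi, Finset.mem_univ i⟩)

lemma abs_eigenvalues_le_specRad {V : Type*} [Fintype V] [DecidableEq V] {M : Matrix V V ℝ}
    (hM : M.IsHermitian) (i : V) : |hM.eigenvalues i| ≤ specRad M :=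
  le_csSup (M.finite_real_spectrum.image _).bddAbove
    (Set.mem_image_of_mem _ (hM.eigenvalues_mem_spectrum_real i))

/-- For a connected graph on `n ≥ 2` vertices, the spectral radius of the normalized
distance Laplacian is at least `n/(n-1)`; moreover, in case of equality the characteristic
polynomial of the normalized distance Laplacian is `x (x - n/(n-1))^(n-1)`. -/
theorem specRad_normDistLap_ge {n : ℕ} (hn : 2 ≤ n) (G : SimpleGraph (Fin n))
    (hG : G.Connected) :
    (n : ℝ) / ((n : ℝ) - 1) ≤ specRad (normDistLap G) ∧
    (specRad (normDistLap G) = (n : ℝ) / ((n : ℝ) - 1) →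
      (normDistLap G).charpoly =
        Polynomial.X * (Polynomial.X - Polynomial.C ((n : ℝ) / ((n : ℝ) - 1))) ^ (n - 1)) := by
  have : Nontrivial (Fin n) := Fin.nontrivial_iff_two_le.2 hn
  have hM := isHermitian_normDistLap G
  have hn1 : (0 : ℝ) < (n : ℝ) - 1 := by
    have : (2 : ℝ) ≤ n := by exact_mod_cast hn
    linarith
  have hsum : ∑ i, hM.eigenvalues i =
      ((Fintype.card (Fin n) : ℝ) - 1) * ((n : ℝ) / ((n : ℝ) - 1)) := by
    have h := hM.trace_eq_sum_eigenvalues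
    rw [trace_normDistLap hG] at h
    rw [Fintype.card_fin, mul_div_cancel₀ _ hn1.ne']
    simpa using h.symm
  obtain ⟨i₀, h0⟩ : ∃ i, hM.eigenvalues i = 0 := by
    have h := hM.det_eq_prod_eigenvalues
    rw [det_normDistLap] at h
    simpa [Finset.prod_eq_zero_iff] using h.symm
  have hle (i) : hM.eigenvalues i ≤ specRad (normDistLap G) :=
    (le_abs_self _).trans (abs_eigenvalues_le_specRad hM i)
  refine ⟨?_, fun heq => ?_⟩
  · by_contra! hlt
    obtain ⟨i, hi⟩ := exists_ne i₀
    exact ((hle i).trans_lt hlt).ne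
      (eq_of_forall_le_div_card h0 hsum (fun j _ => (hle j).trans hlt.le) hi)
  · rw [hM.charpoly_eq, ← Finset.mul_prod_erase _ _ (Finset.mem_univ i₀), h0,
      Finset.prod_congr rfl fun i hi => by
        rw [eq_of_forall_le_div_card h0 hsum (fun j _ => (hle j).trans heq.le)
          (Finset.ne_of_mem_erase hi)]]
    simp
end

section
/- If T is a tree on n ≥ 2 vertices, then the determinant of its distance matrix is det D(T) = (−1)^{n−1}(n−1)2^{n−2}. -/
open Matrix BigOperators

/-- A bordered matrix whose last row and column exceed those of index `p` by one has determinant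
`-2` times that of the inner matrix with all entries increased by `1 / 2`. -/
lemma Matrix.det_fromBlocks_add_one {m : Type*} [Fintype m] [DecidableEq m] (A : Matrix m m ℝ)
    (p : m) :
    (fromBlocks A (of fun i (_ : Unit) => A i p + 1) (of fun (_ : Unit) j => A p j + 1)
      (of fun (_ _ : Unit) => A p p)).det = -2 * (A + of fun _ _ => 1 / 2).det := by
  have hfactor : fromBlocks A (of fun i (_ : Unit) => A i p + 1)
      (of fun (_ : Unit) j => A p j + 1) (of fun (_ _ : Unit) => A p p) =
      fromBlocks 1 0 (of fun _ j => if j = p then 1 else 0) 1 *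
        (fromBlocks 1 (of fun _ _ => -(1 / 2)) 0 1 *
          fromBlocks (A + of fun _ _ => 1 / 2) 0 (of fun _ _ => 1) (of fun _ _ => -2)) *
        fromBlocks 1 (of fun j _ => if j = p then 1 else 0) 0 1 := by
    simp only [fromBlocks_multiply]
    ext (i | i) (j | j) <;> simp [mul_apply]
    ring
  rw [hfactor]
  simp only [det_mul, det_fromBlocks_zero₁₂, det_fromBlocks_zero₂₁]
  simp [mul_comm]

namespace SimpleGraph

variable {V : Type*} {G : SimpleGraph V}

lemma IsTree.dist_induce (hG : G.IsTree) {s : Set V} (hs : (G.induce s).Connected) (u v : s) :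
    (G.induce s).dist u v = G.dist u v := by
  obtain ⟨p, hp, hpl⟩ := hs.exists_path_of_dist u v
  obtain ⟨q, hq, hql⟩ := hG.connected.exists_path_of_dist (u : V) v
  have hmap : (p.map (Embedding.induce s).toHom).IsPath := hp.map Subtype.val_injective
  have := (hG.existsUnique_path u v).unique hmap hq
  rw [← hpl, ← hql, ← this]
  exact (p.length_map _).symm

lemma Connected.dist_eq_dist_add_one_of_unique_adj (hG : G.Connected) {l p v : V}
    (hadj : G.Adj l p) (huniq : ∀ w, G.Adj l w → w = p) (hv : v ≠ l) :
    G.dist l v = G.dist p v + 1 := by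
  apply le_antisymm
  · have := hG.dist_triangle (u := l) (v := p) (w := v)
    rw [dist_eq_one_iff_adj.mpr hadj] at this
    omega
  · obtain ⟨q, hq⟩ := hG.exists_walk_length_eq_dist l v
    cases q with
    | nil => exact absurd rfl hv
    | cons h q =>
      obtain rfl := huniq _ h
      rw [← hq, Walk.length_cons]
      exact Nat.succ_le_succ (dist_le q)

end SimpleGraph

/-- The determinant of the distance matrix of a tree, with `x` added to every entry. -/
lemma det_distMatrix_add_const_of_isTree (n : ℕ) {V : Type*} [Fintype V] [DecidableEq V]
    (hn : Fintype.card V = n + 1) (G : SimpleGraph V) (hT : G.IsTree) (x : ℝ) :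
    (distMatrix G + of fun _ _ => x).det = (-2) ^ n * (x + n / 2) := by
  classical
  induction n generalizing V x with
  | zero =>
    obtain ⟨a, ha⟩ := Fintype.card_eq_one_iff.mp hn
    have : Unique V := ⟨⟨a⟩, ha⟩
    simp [det_unique, distMatrix]
  | succ n ih =>
    have : Nontrivial V := Fintype.one_lt_card_iff_nontrivial.mp (by omega)
    obtain ⟨l, hl⟩ := hT.exists_vert_degree_one_of_nontrivial
    obtain ⟨p, hlp, huniq⟩ := SimpleGraph.degree_eq_one_iff_existsUnique_adj.mp hl
    have hconn := hT.connected.induce_compl_singleton_of_degree_eq_one hl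
    have hT' : (G.induce {l}ᶜ).IsTree := ⟨hconn, hT.isAcyclic.induce _⟩
    have hdist {v : V} (hv : v ≠ l) :=
      hT.connected.dist_eq_dist_add_one_of_unique_adj hlp huniq hv
    have hcard : Fintype.card ({l}ᶜ : Set V) = n + 1 := by
      rw [Fintype.card_compl_set, hn]; simp
    let p' : ({l}ᶜ : Set V) := ⟨p, hlp.ne'⟩
    let e : ({l}ᶜ : Set V) ⊕ Unit ≃ V :=
      (Equiv.optionEquivSumPUnit _).symm.trans (Equiv.optionSubtypeNe l)
    let A : Matrix ({l}ᶜ : Set V) ({l}ᶜ : Set V) ℝ :=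
      distMatrix (G.induce {l}ᶜ) + of fun _ _ => x
    have hblocks : (distMatrix G + of fun _ _ => x).submatrix e e =
        fromBlocks A (of fun i _ => A i p' + 1) (of fun _ j => A p' j + 1)
          (of fun _ _ => A p' p') := by
      have hel (i) : e (Sum.inl i) = i := rfl
      have her (i) : e (Sum.inr i) = l := rfl
      ext (i | i) (j | j)
      · simp [A, distMatrix, hel, hT.dist_induce hconn]
      · have := hdist i.2
        rw [G.dist_comm, G.dist_comm (u := p)] at this
        simp [A, distMatrix, hel, her, hT.dist_induce hconn, this, p']
        ring
      · simp [A, distMatrix, hel, her, hT.dist_induce hconn, hdist j.2, p']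
        ring
      · simp [A, distMatrix, her]
    rw [← det_submatrix_equiv_self e, hblocks, det_fromBlocks_add_one]
    have hA : A + of (fun _ _ => 1 / 2) =
        distMatrix (G.induce {l}ᶜ) + of fun _ _ => x + 1 / 2 := by
      rw [add_assoc]
      rfl
    rw [hA, ih hcard _ hT']
    push_cast
    ring

/-- The determinant of the distance matrix of a tree on `n ≥ 2` vertices is
`(-1)^(n-1) (n-1) 2^(n-2)`. -/
theorem det_distMatrix_of_isTree {n : ℕ} (hn : 2 ≤ n) (G : SimpleGraph (Fin n))
    (hT : G.IsTree) :
    (distMatrix G).det = (-1 : ℝ) ^ (n - 1) * ((n : ℝ) - 1) * 2 ^ (n - 2) := by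
  obtain ⟨k, rfl⟩ := Nat.exists_eq_add_of_le' hn
  have h := det_distMatrix_add_const_of_isTree (k + 1) (by simp) G hT 0
  have hzero : (of fun _ _ => 0 : Matrix (Fin (k + 2)) (Fin (k + 2)) ℝ) = 0 := rfl
  rw [hzero, add_zero] at h
  rw [h, neg_pow]
  simp only [Nat.add_sub_cancel, show k + 2 - 1 = k + 1 from rfl]
  push_cast
  ring
end

section
/- If T is a tree on n ≥ 2 vertices, then the distance matrix D(T) has exactly one positive eigenvalue and exactly n − 1 negative eigenvalues (counted with multiplicity). -/
open Matrix BigOperators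

namespace SimpleGraph.IsTree

variable {V : Type*} {G : SimpleGraph V}

/-- In a tree, a vertex `v ≠ u` has exactly one neighbour that is closer to `u`. -/
theorem exists_adj_dist_eq_ite [DecidableEq V] (hT : G.IsTree) {u v : V} (huv : u ≠ v) :
    ∃ w, G.Adj v w ∧ ∀ z, G.Adj v z →
      (G.dist z u : ℝ) = G.dist v u + 1 - 2 * (if z = w then 1 else 0) := by
  obtain ⟨p, hp, hlen⟩ := hT.connected.exists_path_of_dist v u
  have hnil : ¬ p.Nil := Walk.not_nil_of_ne huv.symm
  refine ⟨p.snd, p.adj_snd hnil, fun z hz => ?_⟩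
  by_cases hzw : z = p.snd
  · subst hzw
    have htail : G.dist p.snd u ≤ p.tail.length := dist_le _
    have hlt := p.length_tail_add_one hnil
    have := hT.dist_eq_dist_add_one_of_adj u hz
    rw [dist_comm (u := u), dist_comm (u := u)] at this
    have heq : G.dist v u = G.dist p.snd u + 1 := by omega
    simp only [if_true, heq]
    push_cast
    ring
  · have hfar : G.dist z u = G.dist v u + 1 := by
      have := hT.dist_eq_dist_add_one_of_adj u hz
      rw [dist_comm (u := u), dist_comm (u := u)] at this
      refine this.resolve_left fun hclose => hzw ?_
      obtain ⟨q, hq⟩ := hT.connected.exists_walk_length_eq_dist z u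
      have hqp : (Walk.cons hz q).IsPath :=
        Walk.isPath_of_length_eq_dist _ (by rw [Walk.length_cons, hq, hclose])
      have := (hT.existsUnique_path v u).unique hp hqp
      rw [this, Walk.snd_cons]
    simp [hzw, hfar]

variable [Fintype V] [DecidableEq V] [DecidableRel G.Adj]

theorem degree_mul_dist_sub_sum_neighbor_dist (hT : G.IsTree) (u v : V) :
    (G.degree v : ℝ) * G.dist v u - ∑ w ∈ G.neighborFinset v, (G.dist w u : ℝ) =
      2 - G.degree v - 2 * (if v = u then 1 else 0) := by
  by_cases huv : u = v
  · subst huv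
    have : ∑ w ∈ G.neighborFinset u, (G.dist w u : ℝ) = ∑ w ∈ G.neighborFinset u, 1 :=
      Finset.sum_congr rfl fun w hw => by
        rw [mem_neighborFinset] at hw
        rw [dist_eq_one_iff_adj.mpr hw.symm, Nat.cast_one]
    rw [this]
    simp
  · obtain ⟨w, hw, hdist⟩ := hT.exists_adj_dist_eq_ite huv
    rw [Finset.sum_congr rfl fun z hz => hdist z ((mem_neighborFinset _ _ _).mp hz),
      Finset.sum_sub_distrib, ← Finset.mul_sum, Finset.sum_ite_eq',
      if_pos ((mem_neighborFinset _ _ _).mpr hw), Finset.sum_const, card_neighborFinset_eq_degree,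
      if_neg (Ne.symm huv), nsmul_eq_mul]
    ring

theorem lapMatrix_mulVec_distMatrix_mulVec (hT : G.IsTree) {x : V → ℝ} (hx : ∑ v, x v = 0) :
    G.lapMatrix ℝ *ᵥ (distMatrix G *ᵥ x) = (-2 : ℝ) • x := by
  ext v
  have hD (w : V) : (distMatrix G *ᵥ x) w = ∑ u, (G.dist w u : ℝ) * x u := rfl
  have hsum : ∑ u, (2 - (G.degree v : ℝ)) * x u = 0 := by rw [← Finset.mul_sum, hx, mul_zero]
  calc (G.lapMatrix ℝ *ᵥ (distMatrix G *ᵥ x)) v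
      = ∑ u, ((G.degree v : ℝ) * G.dist v u -
          ∑ w ∈ G.neighborFinset v, (G.dist w u : ℝ)) * x u := by
        simp only [lapMatrix_mulVec_apply, hD, sub_mul, Finset.sum_sub_distrib, Finset.mul_sum,
          Finset.sum_mul, mul_assoc]
        rw [Finset.sum_comm]
    _ = ∑ u, ((2 - (G.degree v : ℝ)) * x u - if v = u then 2 * x u else 0) := by
        refine Finset.sum_congr rfl fun u _ => ?_
        rw [hT.degree_mul_dist_sub_sum_neighbor_dist]
        split_ifs <;> ring
    _ = ((-2 : ℝ) • x) v := by
        rw [Finset.sum_sub_distrib, hsum, Finset.sum_ite_eq]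
        simp

end SimpleGraph.IsTree

/-- The distance matrix of a tree is negative definite on the vectors with zero coordinate sum. -/
theorem SimpleGraph.IsTree.dotProduct_distMatrix_mulVec_neg {V : Type*} [Fintype V]
    {G : SimpleGraph V} (hT : G.IsTree) {x : V → ℝ} (hx : ∑ v, x v = 0) (hx0 : x ≠ 0) :
    x ⬝ᵥ (distMatrix G *ᵥ x) < 0 := by
  classical
  set f := distMatrix G *ᵥ x with hf
  have hL : G.lapMatrix ℝ *ᵥ f = (-2 : ℝ) • x := hT.lapMatrix_mulVec_distMatrix_mulVec hx
  have hquad : f ⬝ᵥ (G.lapMatrix ℝ *ᵥ f) = -2 * (x ⬝ᵥ f) := by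
    rw [hL, dotProduct_smul, smul_eq_mul, dotProduct_comm]
  have hpsd := SimpleGraph.posSemidef_lapMatrix ℝ G
  have hnonneg : 0 ≤ f ⬝ᵥ (G.lapMatrix ℝ *ᵥ f) := by
    simpa using hpsd.dotProduct_mulVec_nonneg f
  refine lt_of_le_of_ne (by linarith) fun h0 => hx0 ?_
  have hLf : G.lapMatrix ℝ *ᵥ f = 0 := by
    rw [← hpsd.dotProduct_mulVec_zero_iff, star_trivial, hquad, h0, mul_zero]
  rw [hL] at hLf
  exact (smul_eq_zero.mp hLf).resolve_left (by norm_num)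

namespace Matrix.IsHermitian

variable {ι : Type*} [Fintype ι] [DecidableEq ι] {A : Matrix ι ι ℝ}

/-- A symmetric matrix that is negative definite on the vectors with zero coordinate sum has at
most one nonnegative eigenvalue. -/
theorem eq_of_eigenvalues_nonneg (hA : A.IsHermitian)
    (hneg : ∀ x : ι → ℝ, ∑ i, x i = 0 → x ≠ 0 → x ⬝ᵥ (A *ᵥ x) < 0) {i j : ι}
    (hi : 0 ≤ hA.eigenvalues i) (hj : 0 ≤ hA.eigenvalues j) : i = j := by
  by_contra hij
  set p : ι → ℝ := ⇑(hA.eigenvectorBasis i) with hp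
  set q : ι → ℝ := ⇑(hA.eigenvectorBasis j) with hq
  have hdot (k l : ι) : (⇑(hA.eigenvectorBasis k) : ι → ℝ) ⬝ᵥ ⇑(hA.eigenvectorBasis l) =
      if l = k then 1 else 0 := by
    have := orthonormal_iff_ite.mp hA.eigenvectorBasis.orthonormal l k
    simpa [EuclideanSpace.inner_eq_star_dotProduct] using this
  have hpp : p ⬝ᵥ p = 1 := by simpa using hdot i i
  have hqq : q ⬝ᵥ q = 1 := by simpa using hdot j j
  have hpq : p ⬝ᵥ q = 0 := by simpa [Ne.symm hij] using hdot i j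
  have hqp : q ⬝ᵥ p = 0 := by rw [dotProduct_comm, hpq]
  have hAp : A *ᵥ p = hA.eigenvalues i • p := hA.mulVec_eigenvectorBasis i
  have hAq : A *ᵥ q = hA.eigenvalues j • q := hA.mulVec_eigenvectorBasis j
  have hform (a b : ℝ) : (a • p + b • q) ⬝ᵥ (A *ᵥ (a • p + b • q)) =
      a ^ 2 * hA.eigenvalues i + b ^ 2 * hA.eigenvalues j := by
    simp only [mulVec_add, mulVec_smul, hAp, hAq, add_dotProduct, dotProduct_add, smul_dotProduct,
      dotProduct_smul, hpp, hqq, hpq, hqp, smul_eq_mul]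
    ring
  have key (a b : ℝ) (hsum : a * ∑ k, p k + b * ∑ k, q k = 0) : a = 0 := by
    by_contra ha
    refine absurd (hneg (a • p + b • q) ?_ fun h0 => ha ?_) ?_
    · simpa [Finset.sum_add_distrib, Finset.mul_sum] using hsum
    · simpa [dotProduct_add, hpp, hpq] using congrArg (p ⬝ᵥ ·) h0
    · rw [hform]
      exact not_lt.mpr (by positivity)
  have hq0 : ∑ k, q k = 0 := key (∑ k, q k) (-∑ k, p k) (by ring)
  refine absurd (hneg q hq0 fun h0 => ?_) ?_
  · simp [h0] at hqq
  · have := hform 0 1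
    simp only [zero_smul, one_smul, zero_add] at this
    rw [this]
    exact not_lt.mpr (by positivity)

/-- The inertia of a traceless symmetric matrix that is negative definite on the vectors with zero
coordinate sum. -/
theorem inertia_of_trace_eq_zero [Nontrivial ι] (hA : A.IsHermitian) (htr : A.trace = 0)
    (hneg : ∀ x : ι → ℝ, ∑ i, x i = 0 → x ≠ 0 → x ⬝ᵥ (A *ᵥ x) < 0) :
    (Finset.univ.filter fun i => 0 < hA.eigenvalues i).card = 1 ∧
    (Finset.univ.filter fun i => hA.eigenvalues i < 0).card = Fintype.card ι - 1 := by
  have hsum : ∑ i, hA.eigenvalues i = 0 := by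
    simpa [htr] using hA.trace_eq_sum_eigenvalues.symm
  obtain ⟨i, -, hi⟩ := Finset.exists_le_of_sum_le (s := Finset.univ) (f := fun _ => (0 : ℝ))
    (g := hA.eigenvalues) Finset.univ_nonempty (by simp [hsum])
  have hlt {j : ι} (hj : j ≠ i) : hA.eigenvalues j < 0 :=
    not_le.mp fun h => hj (hA.eq_of_eigenvalues_nonneg hneg h hi)
  have hpos : 0 < hA.eigenvalues i := by
    obtain ⟨j, hj⟩ := exists_ne i
    have hrest : ∑ k ∈ Finset.univ.erase i, hA.eigenvalues k < 0 :=
      Finset.sum_neg (fun k hk => hlt (Finset.ne_of_mem_erase hk)) ⟨j, by simp [hj]⟩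
    linarith [Finset.add_sum_erase Finset.univ hA.eigenvalues (Finset.mem_univ i)]
  constructor
  · rw [Finset.card_eq_one]
    refine ⟨i, Finset.ext fun j => ?_⟩
    simp only [Finset.mem_filter, Finset.mem_univ, true_and, Finset.mem_singleton]
    exact ⟨fun h => by_contra fun hj => (hlt hj).not_gt h, fun h => h ▸ hpos⟩
  · rw [← Finset.card_univ, ← Finset.card_erase_of_mem (Finset.mem_univ i)]
    congr 1
    ext j
    simp only [Finset.mem_filter, Finset.mem_univ, true_and, Finset.mem_erase, and_true]
    exact ⟨fun h hj => (hj ▸ h).not_gt hpos, hlt⟩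

end Matrix.IsHermitian

/-- The distance matrix of a tree on `n ≥ 2` vertices has exactly one positive eigenvalue
and exactly `n - 1` negative eigenvalues (counted with multiplicity). -/
theorem distMatrix_inertia_of_isTree {n : ℕ} (hn : 2 ≤ n) (G : SimpleGraph (Fin n))
    (hT : G.IsTree) (hH : (distMatrix G).IsHermitian) :
    (Finset.univ.filter fun i => 0 < hH.eigenvalues i).card = 1 ∧
    (Finset.univ.filter fun i => hH.eigenvalues i < 0).card = n - 1 := by
  have : Nontrivial (Fin n) := Fin.nontrivial_iff_two_le.mpr hn
  have htr : (distMatrix G).trace = 0 := by simp [distMatrix, Matrix.trace]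
  simpa using hH.inertia_of_trace_eq_zero htr fun x => hT.dotProduct_distMatrix_mulVec_neg
end

section
/- Let G be a conference graph of order n ≥ 13, i.e., a connected strongly regular graph with parameters (n, (n−1)/2, (n−5)/4, (n−1)/4) (so n ≡ 1 mod 4). Then the number of positive eigenvalues of the distance matrix D(G) is strictly greater than the number of negative eigenvalues of D(G) (both counted with multiplicity); i.e., G is optimistic. -/
open Matrix BigOperators

/-- The sum of the squares of the eigenvalues of a Hermitian matrix is the trace of its square. -/
theorem Matrix.IsHermitian.trace_sq_eq_sum_sq_eigenvalues {V : Type*} [Fintype V] [DecidableEq V]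
    {M : Matrix V V ℝ} (hM : M.IsHermitian) :
    (M ^ 2).trace = ∑ i, hM.eigenvalues i ^ 2 := by
  conv_lhs => rw [hM.spectral_theorem, ← map_pow, Unitary.conjStarAlgAut_apply, trace_mul_comm,
    ← mul_assoc]
  simp [diagonal_pow, trace_diagonal]

/-- A polynomial matrix identity `(M - l) (M² + p M + q) = 0` passes to the eigenvalues. -/
theorem Matrix.IsHermitian.eigenvalues_cubic {V : Type*} [Fintype V] [DecidableEq V]
    {M : Matrix V V ℝ} (hM : M.IsHermitian) {l p q : ℝ}
    (h : (M - l • 1) * (M ^ 2 + p • M + q • 1) = 0) (i : V) :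
    (hM.eigenvalues i - l) * (hM.eigenvalues i ^ 2 + p * hM.eigenvalues i + q) = 0 := by
  have hv := hM.mulVec_eigenvectorBasis i
  have hne : (hM.eigenvectorBasis i : V → ℝ) ≠ 0 := fun h0 =>
    hM.eigenvectorBasis.toBasis.ne_zero i (by ext j; simpa using congrFun h0 j)
  generalize (hM.eigenvectorBasis i : V → ℝ) = v at hv hne
  generalize hM.eigenvalues i = x at hv
  have h1 := congrArg (· *ᵥ v) h
  simp only [← mulVec_mulVec, sub_mulVec, add_mulVec, smul_mulVec, pow_two, one_mulVec, hv,
    mulVec_smul, mulVec_add, zero_mulVec] at h1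
  refine (smul_eq_zero.mp (?_ : _ • v = 0)).resolve_right hne
  rw [← h1]
  module

/-- In a strongly regular graph with `μ > 0` any two distinct nonadjacent vertices are at
distance two. -/
theorem SimpleGraph.IsSRGWith.dist_eq_two {V : Type*} [Fintype V] [DecidableEq V]
    {G : SimpleGraph V} [DecidableRel G.Adj] {n k a c : ℕ} (h : G.IsSRGWith n k a c) (hc : 0 < c)
    {u v : V} (hne : u ≠ v) (hadj : ¬ G.Adj u v) : G.dist u v = 2 := by
  have hcard := h.of_not_adj hne hadj
  have : Nonempty (G.commonNeighbors u v) := Fintype.card_pos_iff.mp (by omega)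
  have h2 := SimpleGraph.edist_eq_two_iff.mpr ⟨hne, hadj, Set.nonempty_coe_sort.mp this⟩
  simp [SimpleGraph.dist, h2]

/-- The distance matrix of a strongly regular graph with `μ > 0` is `2 (J - I) - A`. -/
theorem SimpleGraph.IsSRGWith.distMatrix_eq {V : Type*} [Fintype V] [DecidableEq V]
    {G : SimpleGraph V} [DecidableRel G.Adj] {n k a c : ℕ} (h : G.IsSRGWith n k a c)
    (hc : 0 < c) :
    distMatrix G = (2 : ℝ) • (of fun _ _ => 1) - (2 : ℝ) • 1 - G.adjMatrix ℝ := by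
  ext u v
  by_cases huv : u = v
  · subst huv
    simp [distMatrix]
  by_cases hadj : G.Adj u v
  · simp [distMatrix, huv, hadj, SimpleGraph.dist_eq_one_iff_adj.mpr hadj]
    norm_num
  · simp [distMatrix, huv, hadj, h.dist_eq_two hc huv hadj]

/-- The quadratic equation satisfied by the distance matrix of a conference graph, up to a multiple
of the all-ones matrix `J`, and the eigenvalue belonging to `J`. -/
theorem conference_distMatrix_equations {V : Type*} [Fintype V] [DecidableEq V]
    {G : SimpleGraph V} [DecidableRel G.Adj] {n k a c : ℕ} (h : G.IsSRGWith n k a c)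
    (hc : 0 < c) (hn : n = 4 * c + 1) (hk : k = 2 * c) (ha : a + 1 = c) :
    distMatrix G ^ 2 + (3 : ℝ) • distMatrix G + ((9 - n : ℝ) / 4) • 1 =
        ((9 * n - 1 : ℝ) / 4) • (of fun _ _ => (1 : ℝ)) ∧
      distMatrix G * (of fun _ _ => (1 : ℝ)) =
        (3 * (n - 1 : ℝ) / 2) • (of fun _ _ => (1 : ℝ)) := by
  have hD := h.distMatrix_eq hc
  have hA := h.matrix_eq (α := ℝ)
  have hC : Gᶜ.adjMatrix ℝ = (of fun _ _ => (1 : ℝ)) - 1 - G.adjMatrix ℝ := by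
    ext u v
    by_cases huv : u = v
    · simp [huv]
    · by_cases hadj : G.Adj u v <;> simp [huv, hadj]
  rw [hC] at hA
  have hJJ : (of fun _ _ => (1 : ℝ) : Matrix V V ℝ) * (of fun _ _ => (1 : ℝ)) =
      (n : ℝ) • (of fun _ _ => (1 : ℝ)) := by
    ext u v
    simp [mul_apply, h.card]
  have hAJ : G.adjMatrix ℝ * (of fun _ _ => (1 : ℝ)) = (k : ℝ) • (of fun _ _ => (1 : ℝ)) := by
    ext u v
    simp [h.regular.degree_eq]
  have hJA : (of fun _ _ => (1 : ℝ)) * G.adjMatrix ℝ = (k : ℝ) • (of fun _ _ => (1 : ℝ)) := by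
    ext u v
    simp [h.regular.degree_eq]
  have hnR : (n : ℝ) = 4 * c + 1 := by exact_mod_cast hn
  have hkR : (k : ℝ) = 2 * c := by exact_mod_cast hk
  have haR : (a : ℝ) = c - 1 := by rw [← ha]; push_cast; ring
  simp only [← Nat.cast_smul_eq_nsmul ℝ] at hA
  rw [hD]
  rw [pow_two] at hA ⊢
  simp only [sub_mul, mul_sub, smul_mul_assoc, mul_smul_comm, hJJ, hAJ, hJA, hA, one_mul, mul_one,
    hnR, hkR, haR]
  constructor <;> module

/-- A conference graph of order `n ≥ 13`, i.e. a connected strongly regular graph with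
parameters `(n, (n-1)/2, (n-5)/4, (n-1)/4)`, is optimistic: its distance matrix has more
positive eigenvalues than negative eigenvalues (counted with multiplicity). -/
theorem conference_graph_optimistic {n k a c : ℕ} (hn : 13 ≤ n)
    (G : SimpleGraph (Fin n)) [DecidableRel G.Adj] (hG : G.Connected)
    (hk : 2 * k = n - 1) (ha : 4 * a = n - 5) (hc : 4 * c = n - 1)
    (hSRG : G.IsSRGWith n k a c) (hH : (distMatrix G).IsHermitian) :
    (Finset.univ.filter fun i => hH.eigenvalues i < 0).card <
      (Finset.univ.filter fun i => 0 < hH.eigenvalues i).card := by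
  obtain ⟨hquad, hJ⟩ := conference_distMatrix_equations hSRG (by omega) (by omega) (by omega)
    (by omega)
  have hcubic : (distMatrix G - (3 * (n - 1 : ℝ) / 2) • 1) *
      (distMatrix G ^ 2 + (3 : ℝ) • distMatrix G + ((9 - n : ℝ) / 4) • 1) = 0 := by
    rw [hquad, mul_smul_comm, sub_mul, hJ, smul_mul_assoc, one_mul, sub_self, smul_zero]
  have hD0 : (distMatrix G).trace = 0 := by simp [trace, distMatrix]
  have htr : ∑ i, hH.eigenvalues i = 0 := by
    have h := hH.trace_eq_sum_eigenvalues
    simp only [RCLike.ofReal_real_eq_id, id_eq] at h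
    rw [← h, hD0]
  have htr2 : ∑ i, hH.eigenvalues i ^ 2 = 5 * n * (n - 1) / 2 := by
    have h := congrArg trace hquad
    have hJt : (of fun _ _ => 1 : Matrix (Fin n) (Fin n) ℝ).trace = n := by simp [trace]
    simp only [trace_add, trace_smul, hH.trace_sq_eq_sum_sq_eigenvalues, hD0, hJt, trace_one,
      Fintype.card_fin, smul_eq_mul] at h
    linear_combination h
  have hnR : (13 : ℝ) ≤ n := by exact_mod_cast hn
  obtain ⟨s, hs, hsn⟩ : ∃ s : ℝ, 3 < s ∧ s ^ 2 = n :=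
    ⟨√n, Real.lt_sqrt_of_sq_lt (by linarith), Real.sq_sqrt (by linarith)⟩
  have hq : (n * (9 * n - 1) / 4 : ℝ) ≠ 0 := by nlinarith
  have hsign (i : Fin n) : ((if 0 < hH.eigenvalues i then 1 else 0) -
      (if hH.eigenvalues i < 0 then 1 else 0) : ℝ) = (2 * hH.eigenvalues i + 3) / s +
        (1 - 3 * s) * (hH.eigenvalues i ^ 2 + 3 * hH.eigenvalues i + (9 - n) / 4) /
          (n * (9 * n - 1) / 4) := by
    have hi := hH.eigenvalues_cubic hcubic i
    generalize hH.eigenvalues i = x at hi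
    rw [← hsn] at hi hq ⊢
    rcases mul_eq_zero.mp hi with h | h
    · obtain rfl : x = 3 * (s ^ 2 - 1) / 2 := by linarith
      rw [if_pos (by nlinarith), if_neg (by nlinarith), show (3 * (s ^ 2 - 1) / 2) ^ 2 +
        3 * (3 * (s ^ 2 - 1) / 2) + (9 - s ^ 2) / 4 = s ^ 2 * (9 * s ^ 2 - 1) / 4 by ring,
        mul_div_cancel_right₀ _ hq]
      field_simp
      ring
    · rw [h]
      have h' : (x - (s - 3) / 2) * (x + (s + 3) / 2) = 0 := by linear_combination h
      rcases mul_eq_zero.mp h' with h' | h'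
      · obtain rfl : x = (s - 3) / 2 := by linarith
        rw [if_pos (by linarith), if_neg (by linarith)]
        field_simp
        ring
      · obtain rfl : x = -((s + 3) / 2) := by linarith
        rw [if_neg (by linarith), if_pos (by linarith)]
        field_simp
        ring
  have hsum := Finset.sum_congr (rfl : (Finset.univ : Finset (Fin n)) = _) fun i _ => hsign i
  rw [Finset.sum_sub_distrib, Finset.sum_boole, Finset.sum_boole, Finset.sum_add_distrib,
    ← Finset.sum_div, ← Finset.sum_div, ← Finset.mul_sum, Finset.sum_add_distrib,
    Finset.sum_add_distrib, Finset.sum_add_distrib, ← Finset.mul_sum, ← Finset.mul_sum, htr,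
    htr2] at hsum
  simp only [Finset.sum_const, Finset.card_univ, Fintype.card_fin, nsmul_eq_mul] at hsum
  have hone : ((2 * 0 + n * 3) / s + (1 - 3 * s) * (5 * n * (n - 1) / 2 + 3 * 0 +
      n * ((9 - n) / 4)) / (n * (9 * n - 1) / 4) : ℝ) = 1 := by
    rw [show (5 * n * (n - 1) / 2 + 3 * 0 + n * ((9 - n) / 4) : ℝ) = n * (9 * n - 1) / 4 by ring,
      mul_div_cancel_right₀ _ hq, ← hsn]
    field_simp
    ring
  rw [hone] at hsum
  have : ((Finset.univ.filter fun i => hH.eigenvalues i < 0).card : ℝ) <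
      (Finset.univ.filter fun i => 0 < hH.eigenvalues i).card := by linarith
  exact_mod_cast this
end
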